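/- Let (y_j)_{j≥-1} be defined by y_{-1} = y_0 = 1 and y_j = (2j-1) y_{j-1} + y_{j-2} for j ≥ 1. Then for every p ∈ (0,1), (1 - e^{-√p}) / (1 - e^{-1}) = 1 - ∑_{k=1}^∞ c_k (1-p)^k, where c_k = y_{k-1} / ((e-1) · 2^k · k!). Moreover all c_k are nonnegative and ∑_{k=1}^∞ c_k = 1. -/

import Mathlib

open Filter Topology

/-- The analytic function `z ↦ exp (1 - √(1 - z))`. -/
noncomputable def expOneSubSqrt (z : ℂ) : ℂ := Complex.exp (1 - (1 - z) ^ (1 / 2 : ℂ))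

lemma one_sub_mem_slitPlane {z : ℂ} (hz : z ∈ Metric.ball (0 : ℂ) 1) :
    1 - z ∈ Complex.slitPlane := by
  rw [sub_eq_add_neg]
  exact Complex.mem_slitPlane_of_norm_lt_one (by simpa using hz)

lemma cpow_half_mul_self (w : ℂ) (hw : w ≠ 0) : w ^ (1 / 2 : ℂ) * w ^ (1 / 2 : ℂ) = w := by
  rw [← Complex.cpow_add _ _ hw]
  norm_num

lemma hasDerivAt_one_sub_cpow_half {z : ℂ} (hz : z ∈ Metric.ball (0 : ℂ) 1) :
    HasDerivAt (fun z : ℂ => (1 - z) ^ (1 / 2 : ℂ)) (-(1 / (2 * (1 - z) ^ (1 / 2 : ℂ)))) z := by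
  have hs := one_sub_mem_slitPlane hz
  have h0 := Complex.slitPlane_ne_zero hs
  have hsq := cpow_half_mul_self _ h0
  have hne : (1 - z) ^ (1 / 2 : ℂ) ≠ 0 := by simp [h0]
  refine (((hasDerivAt_id z).const_sub 1).cpow_const (c := 1 / 2) hs).congr_deriv ?_
  rw [id_eq, Complex.cpow_sub _ _ h0, Complex.cpow_one]
  generalize (1 - z) ^ (1 / 2 : ℂ) = s at *
  rw [← hsq]
  field_simp

lemma hasDerivAt_expOneSubSqrt {z : ℂ} (hz : z ∈ Metric.ball (0 : ℂ) 1) :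
    HasDerivAt expOneSubSqrt (expOneSubSqrt z / (2 * (1 - z) ^ (1 / 2 : ℂ))) z := by
  refine ((hasDerivAt_one_sub_cpow_half hz).const_sub 1).cexp.congr_deriv ?_
  rw [expOneSubSqrt]
  ring

lemma deriv_deriv_expOneSubSqrt {z : ℂ} (hz : z ∈ Metric.ball (0 : ℂ) 1) :
    4 * (1 - z) * deriv (deriv expOneSubSqrt) z =
      2 * deriv expOneSubSqrt z + expOneSubSqrt z := by
  have h0 := Complex.slitPlane_ne_zero (one_sub_mem_slitPlane hz)
  have hsq := cpow_half_mul_self _ h0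
  have hne : (1 - z) ^ (1 / 2 : ℂ) ≠ 0 := by simp [h0]
  have hev : deriv expOneSubSqrt =ᶠ[𝓝 z]
      fun z => expOneSubSqrt z / (2 * (1 - z) ^ (1 / 2 : ℂ)) := by
    filter_upwards [Metric.isOpen_ball.mem_nhds hz] with w hw
    exact (hasDerivAt_expOneSubSqrt hw).deriv
  rw [hev.deriv_eq, hev.eq_of_nhds, ((hasDerivAt_expOneSubSqrt hz).fun_div
    ((hasDerivAt_one_sub_cpow_half hz).const_mul 2) (by simpa using hne)).deriv]
  generalize (1 - z) ^ (1 / 2 : ℂ) = s at *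
  rw [← hsq]
  field_simp
  ring

lemma differentiableOn_expOneSubSqrt :
    DifferentiableOn ℂ expOneSubSqrt (Metric.ball 0 1) := fun _ hz =>
  (hasDerivAt_expOneSubSqrt hz).differentiableAt.differentiableWithinAt

lemma hasDerivAt_iteratedDeriv_expOneSubSqrt (n : ℕ) {z : ℂ} (hz : z ∈ Metric.ball (0 : ℂ) 1) :
    HasDerivAt (iteratedDeriv n expOneSubSqrt) (iteratedDeriv (n + 1) expOneSubSqrt z) z := by
  rw [iteratedDeriv_succ, iteratedDeriv_eq_iterate]
  exact ((differentiableOn_expOneSubSqrt.analyticAt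
    (Metric.isOpen_ball.mem_nhds hz)).iterated_deriv n).differentiableAt.hasDerivAt

lemma iteratedDeriv_expOneSubSqrt_rec (n : ℕ) {z : ℂ} (hz : z ∈ Metric.ball (0 : ℂ) 1) :
    4 * (1 - z) * iteratedDeriv (n + 2) expOneSubSqrt z =
      (4 * n + 2) * iteratedDeriv (n + 1) expOneSubSqrt z + iteratedDeriv n expOneSubSqrt z := by
  induction n generalizing z with
  | zero =>
    simpa [iteratedDeriv_succ] using deriv_deriv_expOneSubSqrt hz
  | succ n ih =>
    have hl := (((hasDerivAt_id z).const_sub 1).const_mul 4).fun_mul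
      (hasDerivAt_iteratedDeriv_expOneSubSqrt (n + 2) hz)
    have hr := ((hasDerivAt_iteratedDeriv_expOneSubSqrt (n + 1) hz).const_mul
      (4 * n + 2 : ℂ)).fun_add (hasDerivAt_iteratedDeriv_expOneSubSqrt n hz)
    have hev : (fun w => 4 * (1 - id w) * iteratedDeriv (n + 2) expOneSubSqrt w) =ᶠ[𝓝 z]
        fun w => (4 * n + 2) * iteratedDeriv (n + 1) expOneSubSqrt w +
          iteratedDeriv n expOneSubSqrt w := by
      filter_upwards [Metric.isOpen_ball.mem_nhds hz] with w hw
      exact ih hw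
    have h := hl.unique (hr.congr_of_eventuallyEq hev)
    simp only [id] at h
    push_cast
    linear_combination h

lemma iteratedDeriv_expOneSubSqrt_zero {y : ℕ → ℝ} (hy0 : y 0 = 1) (hy1 : y 1 = 1)
    (hyrec : ∀ m : ℕ, y (m + 2) = (2 * (m + 1) - 1) * y (m + 1) + y m) (n : ℕ) :
    iteratedDeriv n expOneSubSqrt 0 = (y n : ℂ) / 2 ^ n := by
  have h0 : (0 : ℂ) ∈ Metric.ball (0 : ℂ) 1 := by simp
  induction n using Nat.twoStepInduction with
  | zero => simp [expOneSubSqrt, hy0]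
  | one =>
    rw [iteratedDeriv_one, (hasDerivAt_expOneSubSqrt h0).deriv]
    simp [expOneSubSqrt, hy1]
  | more n ih₀ ih₁ =>
    have h := iteratedDeriv_expOneSubSqrt_rec n h0
    rw [ih₀, ih₁] at h
    rw [hyrec]
    push_cast
    linear_combination h / 4

lemma hasSum_exp_one_sub_sqrt {y : ℕ → ℝ} (hy0 : y 0 = 1) (hy1 : y 1 = 1)
    (hyrec : ∀ m : ℕ, y (m + 2) = (2 * (m + 1) - 1) * y (m + 1) + y m)
    {x : ℝ} (hx0 : 0 ≤ x) (hx1 : x < 1) :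
    HasSum (fun n : ℕ => y n / (2 ^ n * n.factorial) * x ^ n) (Real.exp (1 - √(1 - x))) := by
  have hx : (x : ℂ) ∈ Metric.ball (0 : ℂ) 1 := by simpa [abs_of_nonneg hx0] using hx1
  have hval : ((Real.exp (1 - √(1 - x)) : ℝ) : ℂ) = expOneSubSqrt x := by
    rw [expOneSubSqrt, Real.sqrt_eq_rpow, Complex.ofReal_exp, Complex.ofReal_sub,
      Complex.ofReal_cpow (by linarith)]
    push_cast
    rfl
  rw [← Complex.hasSum_ofReal, hval]
  refine (Complex.hasSum_taylorSeries_on_ball differentiableOn_expOneSubSqrt hx).congr_fun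
    fun n => ?_
  rw [iteratedDeriv_expOneSubSqrt_zero hy0 hy1 hyrec]
  push_cast
  simp only [sub_zero, smul_eq_mul]
  field_simp

lemma hasSum_exp_one {y : ℕ → ℝ} (hy0 : y 0 = 1) (hy1 : y 1 = 1)
    (hyrec : ∀ m : ℕ, y (m + 2) = (2 * (m + 1) - 1) * y (m + 1) + y m)
    (hy : ∀ n, 0 ≤ y n) :
    HasSum (fun n : ℕ => y n / (2 ^ n * n.factorial)) (Real.exp 1) := by
  set a : ℕ → ℝ := fun n => y n / (2 ^ n * n.factorial) with ha
  have ha0 : ∀ n, 0 ≤ a n := fun n => div_nonneg (hy n) (by positivity)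
  have hev : ∀ᶠ x : ℝ in 𝓝[<] 1, HasSum (fun n => a n * x ^ n) (Real.exp (1 - √(1 - x))) ∧
      0 ≤ x := by
    filter_upwards [Ioo_mem_nhdsLT (zero_lt_one' ℝ)] with x hx
    exact ⟨hasSum_exp_one_sub_sqrt hy0 hy1 hyrec hx.1.le hx.2, hx.1.le⟩
  have hlim : Tendsto (fun x : ℝ => Real.exp (1 - √(1 - x))) (𝓝[<] 1) (𝓝 (Real.exp 1)) := by
    have hc : Continuous fun x : ℝ => Real.exp (1 - √(1 - x)) := by fun_prop
    simpa using (hc.tendsto 1).mono_left nhdsWithin_le_nhds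
  have hsum : Summable a := by
    refine summable_of_sum_range_le ha0 (c := Real.exp 1) fun N => ?_
    have hpart : Tendsto (fun x : ℝ => ∑ i ∈ Finset.range N, a i * x ^ i) (𝓝[<] 1)
        (𝓝 (∑ i ∈ Finset.range N, a i)) := by
      have hc : Continuous fun x : ℝ => ∑ i ∈ Finset.range N, a i * x ^ i := by fun_prop
      simpa using (hc.tendsto 1).mono_left nhdsWithin_le_nhds
    refine le_of_tendsto_of_tendsto hpart hlim ?_
    filter_upwards [hev] with x hx
    exact sum_le_hasSum _ (fun i _ => mul_nonneg (ha0 i) (pow_nonneg hx.2 i)) hx.1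
  have habel := Real.tendsto_tsum_powerSeries_nhdsWithin_lt hsum.hasSum.tendsto_sum_nat
  rw [← tendsto_nhds_unique (habel.congr' (hev.mono fun x hx => hx.1.tsum_eq)) hlim]
  exact hsum.hasSum

lemma HasSum.bessel_shift {y : ℕ → ℝ} (hy0 : y 0 = 1) {x S : ℝ}
    (h : HasSum (fun n : ℕ => y n / (2 ^ n * n.factorial) * x ^ n) S) :
    HasSum (fun n : ℕ =>
        y (n + 1) / ((Real.exp 1 - 1) * 2 ^ (n + 1) * Nat.factorial (n + 1)) * x ^ (n + 1))
      ((S - 1) / (Real.exp 1 - 1)) := by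
  have h1 := ((hasSum_nat_add_iff' 1).2 h).div_const (Real.exp 1 - 1)
  simp only [Finset.sum_range_one, hy0, pow_zero, Nat.factorial_zero, Nat.cast_one, mul_one,
    div_one] at h1
  refine h1.congr_fun fun n => ?_
  rw [mul_assoc, mul_comm (Real.exp 1 - 1), ← div_div]
  ring


/-- Expansion of `f(p) = (1-e^{-√p})/(1-e^{-1})` as `1 - ∑_{k≥1} c_k (1-p)^k`
with `c_k = y_{k-1}/((e-1) 2^k k!)`, nonnegative coefficients summing to 1.
Here `y n` denotes the paper's Bessel value `y_{n-1}` (shifted index), and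
series coefficients are indexed from 0: `c n` denotes the paper's `c_{n+1}`. -/
theorem stmt15 (y : ℕ → ℝ) (hy0 : y 0 = 1) (hy1 : y 1 = 1)
    (hyrec : ∀ m : ℕ, y (m + 2) = (2 * (m + 1) - 1) * y (m + 1) + y m)
    (p : ℝ) (hp : p ∈ Set.Ioo (0 : ℝ) 1) :
    (∀ n : ℕ, 0 ≤ y (n + 1) / ((Real.exp 1 - 1) * 2 ^ (n + 1) * Nat.factorial (n + 1))) ∧
    HasSum (fun n : ℕ =>
        y (n + 1) / ((Real.exp 1 - 1) * 2 ^ (n + 1) * Nat.factorial (n + 1)) * (1 - p) ^ (n + 1))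
      (1 - (1 - Real.exp (-Real.sqrt p)) / (1 - Real.exp (-1))) ∧
    HasSum (fun n : ℕ =>
        y (n + 1) / ((Real.exp 1 - 1) * 2 ^ (n + 1) * Nat.factorial (n + 1))) 1 := by
  have he : 0 < Real.exp 1 - 1 := by linarith [Real.one_lt_exp_iff.2 one_pos]
  have hy : ∀ n, 0 ≤ y n := by
    intro n
    induction n using Nat.twoStepInduction with
    | zero => simp [hy0]
    | one => simp [hy1]
    | more n ih₀ ih₁ =>
      rw [hyrec]
      have : (0 : ℝ) ≤ 2 * (n + 1) - 1 := by linarith [n.cast_nonneg (α := ℝ)]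
      positivity
  refine ⟨fun n => div_nonneg (hy _) (by positivity), ?_, ?_⟩
  · convert (hasSum_exp_one_sub_sqrt hy0 hy1 hyrec (sub_nonneg.2 hp.2.le)
      (sub_lt_self 1 hp.1)).bessel_shift hy0 using 1
    rw [sub_sub_cancel, sub_eq_add_neg 1 √p, Real.exp_add, Real.exp_neg 1]
    have := he.ne'
    field_simp
    ring
  · have h := hasSum_exp_one hy0 hy1 hyrec hy
    have h1 : HasSum (fun n : ℕ => y n / (2 ^ n * n.factorial) * 1 ^ n) (Real.exp 1) := by
      simpa using h
    simpa [he.ne'] using h1.bessel_shift hy0
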